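/- arXiv:2205.00402 — 2 statements merged into one kernel-verified Lean document; each statement's English description precedes it below -/
import Mathlib

section
/- Let F be the free product of nontrivial groups A_i (i ∈ I) and a free group with basis {g_j : j ∈ J}, let N be a normal subgroup of F, let K ⊆ I ∪ J, and let F_K be the subgroup of F generated by {g_j : j ∈ K ∩ J} and the groups A_i with i ∈ K ∩ I. Let M be the subgroup of F generated by the normal closures (N ∩ A_i)^F (i ∈ I) together with the commutator subgroup [N, N]. Then for v ∈ F one has D_k(v) ≡ 0 mod ℤ[F]·(N − 1) for every k ∈ (I ∪ J) \ K if and only if there exists an element v̂ ∈ F_K such that v·v̂⁻¹ ∈ (F_K ∩ N)^F · M, where (F_K ∩ N)^F is the normal closure of F_K ∩ N in F. -/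
open Monoid
open scoped Pointwise

noncomputable section

/-- The family consisting of the groups `A i` together with one infinite cyclic group for
each `j : J`; its free product is the free product of the `A i` and a free group with
basis indexed by `J`. -/
def mixedFam (ι J : Type) (A : ι → Type) : ι ⊕ J → Type
  | .inl i => A i
  | .inr _ => Multiplicative ℤ

instance mixedFamGroup (ι J : Type) (A : ι → Type) [∀ i, Group (A i)] :
    ∀ x : ι ⊕ J, Group (mixedFam ι J A x)
  | .inl i => inferInstanceAs (Group (A i))
  | .inr _ => inferInstanceAs (Group (Multiplicative ℤ))

/-- The canonical image of `A i` in the free product. -/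
def aEmb {ι J : Type} (A : ι → Type) [∀ i, Group (A i)] (i : ι) :
    A i →* CoprodI (mixedFam ι J A) :=
  (CoprodI.of : mixedFam ι J A (Sum.inl i) →* CoprodI (mixedFam ι J A))

/-- The free generator `g j` of the free factor. -/
def gGen {ι J : Type} (A : ι → Type) [∀ i, Group (A i)] (j : J) :
    CoprodI (mixedFam ι J A) :=
  CoprodI.of (i := Sum.inr j) (Multiplicative.ofAdd (1 : ℤ))

theorem foxDeriv_one {F : Type*} [Group F] {D : F → MonoidAlgebra ℤ F}
    (hD : ∀ u v, D (u * v) = D u * MonoidAlgebra.of ℤ F v + D v) : D 1 = 0 := by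
  simpa only [mul_one, map_one, left_eq_add] using hD 1 1

open Filter in
/-- A cocycle which on generators is computed from a family of derivations `D k` by additive maps
`L k` is computed from them everywhere. -/
theorem eventually_cocycle_eq_sum {κ F B : Type*} [Group F] [AddCommGroup B]
    (D : κ → F → MonoidAlgebra ℤ F)
    (hD : ∀ k u v, D k (u * v) = D k u * MonoidAlgebra.of ℤ F v + D k v)
    (σ : F → F → B) (hσ : ∀ u v h, σ (u * v) h = σ u (v * h) + σ v h)
    (L : κ → MonoidAlgebra ℤ F →+ B) {S : Set F} (hS : Subgroup.closure S = ⊤)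
    (hgen : ∀ x ∈ S, ∃ k, (∀ k', k' ≠ k → D k' x = 0) ∧
      ∀ h, σ x h = L k (D k x * MonoidAlgebra.of ℤ F h)) (v : F) :
    ∀ᶠ T : Finset κ in atTop, ∀ h, σ v h = ∑ k ∈ T, L k (D k v * MonoidAlgebra.of ℤ F h) := by
  have hD1 : ∀ k, D k 1 = 0 := fun k => foxDeriv_one (hD k)
  have hσ1 : ∀ h, σ 1 h = 0 := fun h => by simpa using hσ 1 1 h
  have hv : v ∈ Subgroup.closure S := hS ▸ Subgroup.mem_top v
  induction hv using Subgroup.closure_induction with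
  | mem x hx =>
    obtain ⟨k, hk, hL⟩ := hgen x hx
    filter_upwards [eventually_ge_atTop {k}] with T hT h
    rw [hL, Finset.sum_eq_single_of_mem k (by simpa using hT)]
    intro k' _ hk'
    simp [hk k' hk']
  | one => simp [hD1, hσ1]
  | mul u v _ _ hu hv =>
    filter_upwards [hu, hv] with T hu hv h
    rw [hσ, hu, hv, ← Finset.sum_add_distrib]
    refine Finset.sum_congr rfl fun k _ => ?_
    rw [hD, add_mul, map_add, mul_assoc, (MonoidAlgebra.of ℤ F).map_mul]
  | inv u _ hu =>
    filter_upwards [hu] with T hu h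
    have hσu : σ u⁻¹ h = -σ u (u⁻¹ * h) := by
      have := hσ u u⁻¹ h
      rw [mul_inv_cancel, hσ1] at this
      exact (neg_eq_of_add_eq_zero_right this.symm).symm
    rw [hσu, hu, ← Finset.sum_neg_distrib]
    refine Finset.sum_congr rfl fun k _ => ?_
    have hDu : D k u⁻¹ = -(D k u * MonoidAlgebra.of ℤ F u⁻¹) := by
      have := hD k u u⁻¹
      rw [mul_inv_cancel, hD1] at this
      exact (neg_eq_of_add_eq_zero_right this.symm).symm
    rw [hDu, neg_mul, map_neg, mul_assoc, (MonoidAlgebra.of ℤ F).map_mul]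

/-- The additive extension of `φ : F → B` to the integral group ring. -/
def groupRingExtend {F B : Type*} [AddCommGroup B] (φ : F → B) : MonoidAlgebra ℤ F →+ B :=
  (Finsupp.linearCombination ℤ φ).toAddMonoidHom.comp MonoidAlgebra.coeffAddEquiv.toAddMonoidHom

theorem groupRingExtend_of {F B : Type*} [Group F] [AddCommGroup B] (φ : F → B) (x : F) :
    groupRingExtend φ (MonoidAlgebra.of ℤ F x) = φ x := by
  simp [groupRingExtend]

/-- The left ideal of `ℤ[F]` generated by `N - 1`. -/
abbrev augIdeal {F : Type*} [Group F] (N : Subgroup F) : Ideal (MonoidAlgebra ℤ F) :=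
  Ideal.span {x | ∃ n ∈ N, x = MonoidAlgebra.of ℤ F n - 1}

theorem groupRingExtend_eq_zero {F B : Type*} [Group F] [AddCommGroup B] {N : Subgroup F}
    {φ : F → B} (hφ : ∀ h, ∀ n ∈ N, φ (h * n) = φ h) {x : MonoidAlgebra ℤ F}
    (hx : x ∈ augIdeal N) : groupRingExtend φ x = 0 := by
  suffices h : ∀ a, groupRingExtend φ (a * x) = 0 by simpa only [one_mul] using h 1
  induction hx using Submodule.span_induction with
  | zero => simp
  | add x y _ _ hx hy => intro a; rw [mul_add, map_add, hx, hy, add_zero]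
  | smul b x _ hx => intro a; rw [smul_eq_mul, ← mul_assoc, hx]
  | mem x hx =>
    obtain ⟨n, hn, rfl⟩ := hx
    intro a
    induction a using MonoidAlgebra.induction_on with
    | of m =>
      rw [mul_sub, mul_one, ← (MonoidAlgebra.of ℤ F).map_mul, map_sub, groupRingExtend_of,
        groupRingExtend_of, hφ _ n hn, sub_self]
    | add a b ha hb => rw [add_mul, map_add, ha, hb, add_zero]
    | smul r a ha => rw [smul_mul_assoc, map_zsmul, ha, smul_zero]

theorem mul_of_mem_augIdeal {F : Type*} [Group F] {N : Subgroup F} [N.Normal]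
    {x : MonoidAlgebra ℤ F} (hx : x ∈ augIdeal N) (g : F) :
    x * MonoidAlgebra.of ℤ F g ∈ augIdeal N := by
  induction hx using Submodule.span_induction with
  | zero => simp
  | add x y _ _ hx hy => rw [add_mul]; exact add_mem hx hy
  | smul a x _ hx => rw [smul_eq_mul, mul_assoc]; exact Ideal.mul_mem_left _ a hx
  | mem x hx =>
    obtain ⟨n, hn, rfl⟩ := hx
    have : (MonoidAlgebra.of ℤ F n - 1) * MonoidAlgebra.of ℤ F g =
        MonoidAlgebra.of ℤ F g * (MonoidAlgebra.of ℤ F (g⁻¹ * n * g) - 1) := by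
      rw [sub_mul, mul_sub, ← map_mul, ← map_mul]
      simp [mul_assoc]
    rw [this]
    refine Ideal.mul_mem_left _ _ (Ideal.subset_span ⟨_, ?_, rfl⟩)
    simpa using Subgroup.Normal.conj_mem ‹N.Normal› n hn g⁻¹

theorem mul_of_sub_self_mem_augIdeal {F : Type*} [Group F] {N : Subgroup F}
    (x : MonoidAlgebra ℤ F) {n : F} (hn : n ∈ N) :
    x * MonoidAlgebra.of ℤ F n - x ∈ augIdeal N := by
  have := Ideal.mul_mem_left (augIdeal N) x (Ideal.subset_span ⟨n, hn, rfl⟩)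
  rwa [mul_sub, mul_one] at this

/-- The elements of `N` on which a derivation vanishes modulo `ℤ[F]·(N - 1)`. -/
def derivKernel {F : Type*} [Group F] (N : Subgroup F) [N.Normal] (D : F → MonoidAlgebra ℤ F)
    (hD : ∀ u v, D (u * v) = D u * MonoidAlgebra.of ℤ F v + D v) : Subgroup F where
  carrier := {w | w ∈ N ∧ D w ∈ augIdeal N}
  one_mem' := ⟨N.one_mem, by
    have : D 1 = 0 := foxDeriv_one hD
    simp [this]⟩
  mul_mem' := fun {u v} hu hv => ⟨N.mul_mem hu.1 hv.1, by
    rw [hD]; exact add_mem (mul_of_mem_augIdeal hu.2 v) hv.2⟩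
  inv_mem' := fun {u} hu => ⟨N.inv_mem hu.1, by
    have h1 : D 1 = 0 := foxDeriv_one hD
    have := hD u u⁻¹
    rw [mul_inv_cancel, h1] at this
    rw [← neg_eq_of_add_eq_zero_right this.symm]
    exact neg_mem (mul_of_mem_augIdeal hu.2 _)⟩

section derivKernel

variable {F : Type*} [Group F] {N : Subgroup F} [N.Normal] {D : F → MonoidAlgebra ℤ F}
  {hD : ∀ u v, D (u * v) = D u * MonoidAlgebra.of ℤ F v + D v}

instance derivKernel_normal : (derivKernel N D hD).Normal where
  conj_mem n hn g := by
    refine ⟨Subgroup.Normal.conj_mem ‹_› n hn.1 g, ?_⟩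
    have h1 : D 1 = 0 := foxDeriv_one hD
    have hg : D g * MonoidAlgebra.of ℤ F g⁻¹ + D g⁻¹ = 0 := by rw [← hD, mul_inv_cancel, h1]
    have key : D (g * n * g⁻¹) = (D g * MonoidAlgebra.of ℤ F n - D g) * MonoidAlgebra.of ℤ F g⁻¹
        + D n * MonoidAlgebra.of ℤ F g⁻¹ := by
      rw [hD, hD, ← sub_eq_zero, ← hg]
      noncomm_ring
    rw [key]
    exact add_mem (mul_of_mem_augIdeal (mul_of_sub_self_mem_augIdeal _ hn.1) _)
      (mul_of_mem_augIdeal hn.2 _)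

open scoped commutatorElement in
theorem commutator_le_derivKernel : ⁅N, N⁆ ≤ derivKernel N D hD := by
  rw [Subgroup.commutator_le]
  intro m hm n hn
  refine ⟨Subgroup.commutator_le_right N N (Subgroup.commutator_mem_commutator hm hn), ?_⟩
  have hc : D (⁅m, n⁆ * (n * m)) = D (m * n) := by
    congr 1
    simp [commutatorElement_def, mul_assoc]
  rw [hD] at hc
  have key : D ⁅m, n⁆ * MonoidAlgebra.of ℤ F (n * m) ∈ augIdeal N := by
    have h2 : D ⁅m, n⁆ * MonoidAlgebra.of ℤ F (n * m) =
        (D m * MonoidAlgebra.of ℤ F n - D m) - (D n * MonoidAlgebra.of ℤ F m - D n) := by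
      rw [eq_sub_of_add_eq hc, hD, hD]
      abel
    rw [h2]
    exact sub_mem (mul_of_sub_self_mem_augIdeal _ hn) (mul_of_sub_self_mem_augIdeal _ hm)
  have := mul_of_mem_augIdeal key (n * m)⁻¹
  rwa [mul_assoc, ← map_mul, mul_inv_cancel, map_one, mul_one] at this

end derivKernel

/-- If `q` kills `P ∩ N`, there is a section of `F → F / N` modulo `ker q` which is
equivariant under left multiplication by `P`. -/
theorem exists_equivariant_section {F Q : Type*} [Group F] [Group Q] (q : F →* Q)
    (N P : Subgroup F) [N.Normal] (hP : P ⊓ N ≤ q.ker) :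
    ∃ s : F → Q, (∀ p ∈ P, ∀ h, s (p * h) = q p * s h) ∧ (∀ h, ∀ n ∈ N, s (h * n) = s h) ∧
      ∀ h, (s h)⁻¹ * q h ∈ N.map q := by
  let r : F → F := fun h => (Quotient.mk (QuotientGroup.rightRel (P ⊔ N)) h).out
  have hr : ∀ h, h * (r h)⁻¹ ∈ P ⊔ N := fun h =>
    QuotientGroup.rightRel_apply.1 (Quotient.mk_out (s := QuotientGroup.rightRel (P ⊔ N)) h)
  have hr' : ∀ h h', h' * h⁻¹ ∈ P ⊔ N → r h = r h' := fun h h' hh =>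
    congrArg Quotient.out (Quotient.sound (QuotientGroup.rightRel_apply.2 hh))
  have hf : ∀ h, ∃ f ∈ P, f⁻¹ * h * (r h)⁻¹ ∈ N := fun h => by
    obtain ⟨f, hf, n, hn, hfn⟩ := Subgroup.mem_sup_of_normal_right.1 (hr h)
    exact ⟨f, hf, by rwa [mul_assoc, ← hfn, inv_mul_cancel_left]⟩
  choose f hfP hfN using hf
  have hq : ∀ x ∈ P, ∀ y ∈ P, x⁻¹ * y ∈ N → q x = q y := fun x hx y hy hxy => by
    have : x⁻¹ * y ∈ q.ker := hP ⟨P.mul_mem (P.inv_mem hx) hy, hxy⟩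
    rwa [MonoidHom.mem_ker, map_mul, map_inv, inv_mul_eq_one] at this
  refine ⟨fun h => q (f h) * q (r h), fun p hp h => ?_, fun h n hn => ?_, fun h => ?_⟩
  · have e : r (p * h) = r h := (hr' _ _ (by simpa using Subgroup.mem_sup_left hp)).symm
    have h1 := hfN (p * h)
    rw [e] at h1
    have h2 := N.mul_mem h1 (N.inv_mem (hfN h))
    simp only [e]
    rw [← mul_assoc, ← q.map_mul p]
    congr 1
    refine hq _ (hfP _) _ (P.mul_mem hp (hfP h)) ?_
    convert h2 using 1
    group
  · have e : r (h * n) = r h := (hr' _ _ (Subgroup.mem_sup_right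
      (Subgroup.Normal.conj_mem ‹_› n hn h))).symm
    have h1 := hfN (h * n)
    rw [e] at h1
    have h3 : r h * n * (r h)⁻¹ ∈ N := Subgroup.Normal.conj_mem ‹_› n hn _
    have h2 := N.mul_mem (N.mul_mem h1 (N.inv_mem h3)) (N.inv_mem (hfN h))
    simp only [e]
    congr 1
    refine hq _ (hfP _) _ (hfP h) ?_
    convert h2 using 1
    group
  · have h3 := Subgroup.Normal.conj_mem ‹_› _ (hfN h) (r h)⁻¹
    refine ⟨_, h3, ?_⟩
    simp [mul_assoc]

/-- A cocycle modulo `N` that vanishes on the generators in `K` and is a coboundary on each `A i`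
vanishes wherever the Fox derivatives outside `K` vanish modulo `ℤ[F]·(N - 1)`. -/
theorem cocycle_eq_zero {ι J F B : Type*} {A : ι → Type*} [∀ i, Group (A i)] [Group F]
    [AddCommGroup B] {e : ∀ i, A i →* F} {g : J → F}
    (hgen : Subgroup.closure ({x | ∃ j, x = g j} ∪ {x | ∃ i a, x = e i a}) = ⊤)
    {N : Subgroup F} {D : ι ⊕ J → F → MonoidAlgebra ℤ F}
    (hDmul : ∀ k u v, D k (u * v) = D k u * MonoidAlgebra.of ℤ F v + D k v)
    (hDg : ∀ j, D (Sum.inr j) (g j) = 1)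
    (hDg' : ∀ k j, k ≠ Sum.inr j → D k (g j) = 0)
    (hDa : ∀ i a, D (Sum.inl i) (e i a) = MonoidAlgebra.of ℤ F (e i a) - 1)
    (hDa' : ∀ k i a, k ≠ Sum.inl i → D k (e i a) = 0)
    {K : Set (ι ⊕ J)} {σ : F → F → B}
    (hσ : ∀ u v h, σ (u * v) h = σ u (v * h) + σ v h)
    (hσN : ∀ u h, ∀ n ∈ N, σ u (h * n) = σ u h)
    (hσg : ∀ j h, Sum.inr j ∈ K → σ (g j) h = 0)
    (hσa : ∀ i a h, Sum.inl i ∈ K → σ (e i a) h = 0)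
    {ψ : ι → F → B} (hψN : ∀ i h, ∀ n ∈ N, ψ i (h * n) = ψ i h)
    (hψ : ∀ i a h, σ (e i a) h = ψ i (e i a * h) - ψ i h)
    {v : F} (hv : ∀ k ∉ K, D k v ∈ augIdeal N) : σ v 1 = 0 := by
  classical
  let φ : ι ⊕ J → F → B := Sum.elim ψ fun j => σ (g j)
  let L : ι ⊕ J → MonoidAlgebra ℤ F →+ B := fun k => if k ∈ K then 0 else groupRingExtend (φ k)
  have hLzero : ∀ k, L k (D k v) = 0 := fun k => by
    by_cases hk : k ∈ K
    · simp [L, hk]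
    · simp only [L, if_neg hk]
      refine groupRingExtend_eq_zero (N := N) (fun h n hn => ?_) (hv k hk)
      cases k with
      | inl i => exact hψN i h n hn
      | inr j => exact hσN _ h n hn
  have key := eventually_cocycle_eq_sum D hDmul σ hσ L hgen (by
    rintro x (⟨j, rfl⟩ | ⟨i, a, rfl⟩)
    · refine ⟨Sum.inr j, fun k hk => hDg' k j hk, fun h => ?_⟩
      by_cases hk : Sum.inr j ∈ K
      · simp [L, hk, hσg j h hk]
      · simp only [L, if_neg hk, hDg, one_mul, groupRingExtend_of]
        rfl
    · refine ⟨Sum.inl i, fun k hk => hDa' k i a hk, fun h => ?_⟩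
      by_cases hk : Sum.inl i ∈ K
      · simp [L, hk, hσa i a h hk]
      · simp only [L, if_neg hk, hDa, sub_mul, one_mul, ← map_mul, map_sub, groupRingExtend_of]
        exact hψ i a h) v
  obtain ⟨T, hT⟩ := key.exists
  rw [hT 1]
  exact Finset.sum_eq_zero fun k _ => by rw [map_one, mul_one, hLzero]

open scoped commutatorElement in
/-- The hard direction, for a group generated by the images of the groups `A i` and the
elements `g j`. -/
theorem exists_mul_inv_mem_of_deriv_mem {ι J F : Type*} {A : ι → Type*} [∀ i, Group (A i)]
    [Group F] {e : ∀ i, A i →* F} {g : J → F}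
    (hgen : Subgroup.closure ({x | ∃ j, x = g j} ∪ {x | ∃ i a, x = e i a}) = ⊤)
    {N : Subgroup F} [N.Normal] {D : ι ⊕ J → F → MonoidAlgebra ℤ F}
    (hDmul : ∀ k u v, D k (u * v) = D k u * MonoidAlgebra.of ℤ F v + D k v)
    (hDg : ∀ j, D (Sum.inr j) (g j) = 1)
    (hDg' : ∀ k j, k ≠ Sum.inr j → D k (g j) = 0)
    (hDa : ∀ i a, D (Sum.inl i) (e i a) = MonoidAlgebra.of ℤ F (e i a) - 1)
    (hDa' : ∀ k i a, k ≠ Sum.inl i → D k (e i a) = 0)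
    {K : Set (ι ⊕ J)} {P R : Subgroup F} [R.Normal]
    (hPg : ∀ j, Sum.inr j ∈ K → g j ∈ P) (hPa : ∀ i a, Sum.inl i ∈ K → e i a ∈ P)
    (hRP : P ⊓ N ≤ R) (hRA : ∀ i, N ⊓ (e i).range ≤ R) (hRN : ⁅N, N⁆ ≤ R)
    {v : F} (hv : ∀ k ∉ K, D k v ∈ augIdeal N) : ∃ w ∈ P, v * w⁻¹ ∈ R := by
  classical
  have hvP : v ∈ P ⊔ N := by
    let χ : F → ℤ := fun h => if h ∈ P ⊔ N then 1 else 0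
    have hχP : ∀ p ∈ P, ∀ h, χ (p * h) = χ h := fun p hp h => by
      simp only [χ, Subgroup.mul_mem_cancel_left _ (Subgroup.mem_sup_left hp : p ∈ P ⊔ N)]
    have hχN : ∀ h, ∀ n ∈ N, χ (h * n) = χ h := fun h n hn => by
      simp only [χ, Subgroup.mul_mem_cancel_right _ (Subgroup.mem_sup_right hn : n ∈ P ⊔ N)]
    have h0 : χ (v * 1) - χ 1 = 0 :=
      cocycle_eq_zero (N := N) (K := K) hgen hDmul hDg hDg' hDa hDa'
        (σ := fun u h => χ (u * h) - χ h) (ψ := fun _ => χ)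
        (fun u v h => by simp [mul_assoc])
        (fun u h n hn => by simp only [← mul_assoc, hχN _ n hn])
        (fun j h hj => by simp only [hχP _ (hPg j hj), sub_self])
        (fun i a h hi => by simp only [hχP _ (hPa i a hi), sub_self])
        (fun _ => hχN) (fun _ _ _ => rfl) hv
    by_contra hvP
    simp [χ, hvP] at h0
  let q : F →* F ⧸ R := QuotientGroup.mk' R
  have hker : q.ker = R := QuotientGroup.ker_mk' R
  obtain ⟨s, hsP, hsN, hs⟩ := exists_equivariant_section q N P (hker.symm ▸ hRP)
  have ht := fun i => exists_equivariant_section q N (e i).range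
    (by rw [hker, inf_comm]; exact hRA i)
  choose t htA htN ht using ht
  have hcomm : ∀ x y : N.map q, x * y = y * x := by
    rintro ⟨_, m, hm, rfl⟩ ⟨_, n, hn, rfl⟩
    have h1 : ⁅m, n⁆ ∈ q.ker := hker.symm ▸ hRN (Subgroup.commutator_mem_commutator hm hn)
    rw [MonoidHom.mem_ker, map_commutatorElement, commutatorElement_eq_one_iff_mul_comm] at h1
    exact Subtype.ext h1
  let _ : CommGroup (N.map q) := { (inferInstance : Group (N.map q)) with mul_comm := hcomm }
  have hsmem : ∀ u h, (s (u * h))⁻¹ * q u * s h ∈ N.map q := fun u h => by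
    have h1 := Subgroup.mul_mem _ (hs (u * h)) (Subgroup.inv_mem _ (hs h))
    rw [map_mul] at h1
    convert h1 using 1
    group
  have htmem : ∀ i h, (s h)⁻¹ * t i h ∈ N.map q := fun i h => by
    have h1 := Subgroup.mul_mem _ (hs h) (Subgroup.inv_mem _ (ht i h))
    convert h1 using 1
    group
  have h0 := cocycle_eq_zero (N := N) (K := K) hgen hDmul hDg hDg' hDa hDa'
    (σ := fun u h => Additive.ofMul (⟨_, hsmem u h⟩ : N.map q))
    (ψ := fun i h => Additive.ofMul (⟨_, htmem i h⟩ : N.map q))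
    (fun u v h => by
      rw [← ofMul_mul]
      refine congrArg Additive.ofMul (Subtype.ext ?_)
      simp [mul_assoc])
    (fun u h n hn => by simp only [← mul_assoc, hsN _ n hn])
    (fun j h hj => by
      rw [← ofMul_one]
      refine congrArg Additive.ofMul (Subtype.ext ?_)
      simp [hsP _ (hPg j hj)])
    (fun i a h hi => by
      rw [← ofMul_one]
      refine congrArg Additive.ofMul (Subtype.ext ?_)
      simp [hsP _ (hPa i a hi)])
    (fun i h n hn => by simp only [hsN _ n hn, htN i _ n hn])
    (fun i a h => by
      rw [← ofMul_div]
      refine congrArg Additive.ofMul (Subtype.ext ?_)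
      rw [div_eq_mul_inv]
      simp [htA i (e i a) ⟨a, rfl⟩, mul_assoc]) hv
  have h1 : (s (v * 1))⁻¹ * q v * s 1 = 1 :=
    congrArg (fun x => ((Additive.toMul x : N.map q) : F ⧸ R)) h0
  obtain ⟨w, hw, n, hn, rfl⟩ := Subgroup.mem_sup_of_normal_right.1 hvP
  refine ⟨w, hw, ?_⟩
  have h2 : s (w * n * 1) = q w * s 1 := by
    rw [mul_one, hsN _ n hn, ← hsP w hw 1, mul_one]
  rw [h2] at h1
  have h3 : q (w * n) = q w := by
    rw [mul_assoc, inv_mul_eq_one, mul_left_inj] at h1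
    exact h1.symm
  rw [← hker, MonoidHom.mem_ker, map_mul, h3, map_inv, mul_inv_cancel]

theorem closure_gGen_aEmb {ι J : Type} (A : ι → Type) [∀ i, Group (A i)] :
    Subgroup.closure ({x | ∃ j : J, x = gGen A j} ∪ {x | ∃ i a, x = aEmb A i a}) =
      (⊤ : Subgroup (CoprodI (mixedFam ι J A))) := by
  refine eq_top_iff.2 fun x _ => ?_
  induction x using CoprodI.induction_on with
  | one => exact Subgroup.one_mem _
  | mul x y hx hy => exact Subgroup.mul_mem _ (hx trivial) (hy trivial)
  | of k m =>
    cases k with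
    | inl i => exact Subgroup.subset_closure (Or.inr ⟨i, m, rfl⟩)
    | inr j =>
      let c : Multiplicative ℤ →* CoprodI (mixedFam ι J A) :=
        (CoprodI.of : mixedFam ι J A (Sum.inr j) →* CoprodI (mixedFam ι J A))
      have hc : ∀ z : Multiplicative ℤ, c z = gGen A j ^ z.toAdd := fun z =>
        calc c z = c (Multiplicative.ofAdd 1 ^ z.toAdd) := by rw [← ofAdd_zsmul]; simp
          _ = gGen A j ^ z.toAdd := map_zpow c _ _
      have hj : gGen A j ∈ Subgroup.closure
          ({x | ∃ j : J, x = gGen A j} ∪ {x | ∃ i a, x = aEmb A i a}) :=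
        Subgroup.subset_closure (Or.inl ⟨j, rfl⟩)
      change c m ∈ _
      exact hc m ▸ Subgroup.zpow_mem _ hj _

/-- **Theorem on Fox derivatives in a free product (Theorem 3 of the paper).**
`F = (*_{i ∈ ι} A i) * (free group on J)`, `N` a normal subgroup, `K ⊆ ι ⊕ J`,
`F_K` the subgroup generated by the factors indexed by `K`, and `M` the subgroup generated
by the normal closures `(N ∩ A i)^F` together with `[N, N]`.  The Fox derivatives are
encoded as functions `D k : F → ℤ[F]` satisfying the Fox derivation rules.  For `v : F`:
`D k v ∈ ℤ[F]·(N - 1)` for all `k ∉ K` iff there is `v̂ ∈ F_K` with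
`v·v̂⁻¹ ∈ (F_K ∩ N)^F · M`. -/
theorem statement2 {ι J : Type} (A : ι → Type) [∀ i, Group (A i)]
    [∀ i, Nontrivial (A i)]
    (N : Subgroup (CoprodI (mixedFam ι J A))) [N.Normal]
    (D : ι ⊕ J → CoprodI (mixedFam ι J A) →
      MonoidAlgebra ℤ (CoprodI (mixedFam ι J A)))
    (hDmul : ∀ k u v, D k (u * v)
      = D k u * MonoidAlgebra.of ℤ (CoprodI (mixedFam ι J A)) v + D k v)
    (hDg : ∀ j : J, D (Sum.inr j) (gGen A j) = 1)
    (hDg' : ∀ (k : ι ⊕ J) (j : J), k ≠ Sum.inr j → D k (gGen A j) = 0)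
    (hDa : ∀ (i : ι) (a : A i), D (Sum.inl i) (aEmb A i a)
      = MonoidAlgebra.of ℤ (CoprodI (mixedFam ι J A)) (aEmb A i a) - 1)
    (hDa' : ∀ (k : ι ⊕ J) (i : ι) (a : A i), k ≠ Sum.inl i → D k (aEmb A i a) = 0)
    (K : Set (ι ⊕ J))
    (FK : Subgroup (CoprodI (mixedFam ι J A)))
    (hFK : FK = Subgroup.closure
      ({x | ∃ j : J, Sum.inr j ∈ K ∧ x = gGen A j}
        ∪ {x | ∃ (i : ι) (a : A i), Sum.inl i ∈ K ∧ x = aEmb A i a}))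
    (M : Subgroup (CoprodI (mixedFam ι J A)))
    (hM : M = (⨆ i : ι, Subgroup.normalClosure
        ((N ⊓ (aEmb A i).range : Subgroup (CoprodI (mixedFam ι J A))) :
          Set (CoprodI (mixedFam ι J A)))) ⊔ ⁅N, N⁆)
    (v : CoprodI (mixedFam ι J A)) :
    (∀ k : ι ⊕ J, k ∉ K → D k v ∈ Ideal.span
        {x : MonoidAlgebra ℤ (CoprodI (mixedFam ι J A)) |
          ∃ n ∈ N, x = MonoidAlgebra.of ℤ (CoprodI (mixedFam ι J A)) n - 1})
      ↔ ∃ vh ∈ FK, v * vh⁻¹ ∈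
          ((Subgroup.normalClosure
              ((FK ⊓ N : Subgroup (CoprodI (mixedFam ι J A))) :
                Set (CoprodI (mixedFam ι J A))) :
            Set (CoprodI (mixedFam ι J A))) * (M : Set (CoprodI (mixedFam ι J A)))) := by
  have hnorm : M.Normal := hM ▸ inferInstance
  have hmul := Subgroup.normal_mul (Subgroup.normalClosure
    ((FK ⊓ N : Subgroup (CoprodI (mixedFam ι J A))) : Set (CoprodI (mixedFam ι J A)))) M
  rw [← hmul]
  constructor
  · intro hv
    refine exists_mul_inv_mem_of_deriv_mem (closure_gGen_aEmb A) hDmul hDg hDg' hDa hDa'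
      (fun j hj => ?_) (fun i a hi => ?_) (le_sup_of_le_left Subgroup.le_normalClosure)
      (fun i => le_sup_of_le_right ?_) (le_sup_of_le_right (hM ▸ le_sup_right)) hv
    · exact hFK ▸ Subgroup.subset_closure (Or.inl ⟨j, hj, rfl⟩)
    · exact hFK ▸ Subgroup.subset_closure (Or.inr ⟨i, a, hi, rfl⟩)
    · rw [hM]
      exact le_sup_of_le_left (Subgroup.le_normalClosure.trans (le_iSup (fun i : ι =>
        Subgroup.normalClosure ((N ⊓ (aEmb A i).range :
          Subgroup (CoprodI (mixedFam ι J A))) : Set (CoprodI (mixedFam ι J A)))) i))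
  · rintro ⟨w, hw, hvw⟩ k hk
    have hDFK : ∀ x ∈ FK, D k x = 0 := by
      have h1 : D k 1 = 0 := foxDeriv_one (hDmul k)
      intro x hx
      rw [hFK] at hx
      induction hx using Subgroup.closure_induction with
      | mem x hx =>
        rcases hx with ⟨j, hj, rfl⟩ | ⟨i, a, hi, rfl⟩
        · exact hDg' k j fun h => hk (h ▸ hj)
        · exact hDa' k i a fun h => hk (h ▸ hi)
      | one => exact h1
      | mul x y _ _ hx hy => simp [hDmul, hx, hy]
      | inv x _ hx => simpa [hx, h1] using (hDmul k x x⁻¹).symm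
    have hle : Subgroup.normalClosure ((FK ⊓ N : Subgroup (CoprodI (mixedFam ι J A))) :
        Set (CoprodI (mixedFam ι J A))) ⊔ M ≤ derivKernel N (D k) (hDmul k) := by
      rw [hM]
      refine sup_le (Subgroup.normalClosure_le_normal ?_) (sup_le (iSup_le fun i =>
        Subgroup.normalClosure_le_normal ?_) commutator_le_derivKernel)
      · rintro x ⟨hx, hxN⟩
        refine ⟨hxN, ?_⟩
        rw [hDFK x hx]
        exact zero_mem _
      · rintro _ ⟨hxN, a, rfl⟩
        refine ⟨hxN, ?_⟩
        by_cases hki : k = Sum.inl i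
        · rw [hki, hDa]
          exact Ideal.subset_span ⟨_, hxN, rfl⟩
        · rw [hDa' k i a hki]
          exact zero_mem _
    have h := mul_of_mem_augIdeal (hle hvw).2 w
    rwa [← add_zero (_ * _), ← hDFK w hw, ← hDmul, inv_mul_cancel_right] at h
end
end

section
/- Let F be the free product of nontrivial groups A_i (i ∈ I) and a free group with basis {g_j : j ∈ J}, and let N be a normal subgroup of F such that N ∩ A_i = 1 for all i ∈ I. Then for v ∈ F one has D_k(v) ≡ 0 mod ℤ[F]·(N − 1) for every k ∈ I ∪ J if and only if v ∈ [N, N]. -/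
open Monoid
open scoped Pointwise

noncomputable section

section GroupRingPairing

variable {F X M : Type*} [Group F] [MulAction F X] [AddCommGroup M]

/-- The right action of `ℤ[F]` on functions `X → M` induced by the left action of `F` on `X`,
evaluated at the point `x`: it sends a group element `g` to `f (g • x)`. -/
def pairing (f : X → M) (x : X) : MonoidAlgebra ℤ F →+ M :=
  (Finsupp.liftAddHom fun g : F => (smulAddHom ℤ M).flip (f (g • x))).comp
    MonoidAlgebra.coeffAddEquiv.toAddMonoidHom

lemma pairing_single (f : X → M) (x : X) (g : F) (c : ℤ) :
    pairing f x (MonoidAlgebra.single g c) = c • f (g • x) := by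
  simp [pairing]

lemma pairing_of (f : X → M) (x : X) (g : F) :
    pairing f x (MonoidAlgebra.of ℤ F g) = f (g • x) := by
  simp [MonoidAlgebra.of_apply, pairing_single]

lemma pairing_one (f : X → M) (x : X) : pairing f x (1 : MonoidAlgebra ℤ F) = f x := by
  simp [MonoidAlgebra.one_def, pairing_single]

lemma pairing_mul_of (f : X → M) (x : X) (y : MonoidAlgebra ℤ F) (v : F) :
    pairing f x (y * MonoidAlgebra.of ℤ F v) = pairing f (v • x) y := by
  suffices (pairing f x).comp (AddMonoidHom.mulRight (MonoidAlgebra.of ℤ F v)) =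
      pairing f (v • x) from DFunLike.congr_fun this y
  refine MonoidAlgebra.addMonoidHom_ext fun g c => ?_
  simp [MonoidAlgebra.of_apply, MonoidAlgebra.single_mul_single, pairing_single, mul_smul]

/-- If `N` acts trivially on `X`, the left ideal generated by the `n - 1` pairs to zero. -/
lemma pairing_eq_zero_of_mem_span {N : Subgroup F} (hN : ∀ n ∈ N, ∀ x : X, n • x = x)
    (f : X → M) (x : X) {y : MonoidAlgebra ℤ F}
    (hy : y ∈ Ideal.span {z : MonoidAlgebra ℤ F | ∃ n ∈ N, z = MonoidAlgebra.of ℤ F n - 1}) :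
    pairing f x y = 0 := by
  induction hy using Submodule.span_induction with
  | mem z hz =>
    obtain ⟨n, hn, rfl⟩ := hz
    rw [map_sub, pairing_of, pairing_one, hN n hn, sub_self]
  | zero => exact map_zero _
  | add a b _ _ ha hb => rw [map_add, ha, hb, add_zero]
  | smul r z hz ih =>
    clear ih
    induction hz using Submodule.span_induction generalizing r with
    | mem z hz =>
      obtain ⟨n, hn, rfl⟩ := hz
      rw [smul_eq_mul, mul_sub, mul_one, map_sub, pairing_mul_of, hN n hn, sub_self]
    | zero => rw [smul_zero, map_zero]
    | add a b _ _ ha hb => rw [smul_add, map_add, ha, hb, add_zero]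
    | smul s z _ ih => rw [smul_smul, ih]

end GroupRingPairing

/-- A crossed homomorphism into the functions on a free `A`-set is principal. -/
lemma exists_potential_of_free {A X M : Type*} [Group A] [MulAction A X] [AddCommGroup M]
    (hfree : ∀ (a : A) (x : X), a • x = x → a = 1) (τ : A → X → M)
    (hτ : ∀ a b x, τ (a * b) x = τ a (b • x) + τ b x) :
    ∃ f : X → M, ∀ a x, τ a x = f (a • x) - f x := by
  have hrep : ∀ x : X, ∃ a : A,
      a • (Quotient.out (Quotient.mk (MulAction.orbitRel A X) x)) = x := by
    intro x
    have h := Quotient.mk_out (s := MulAction.orbitRel A X) x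
    exact MulAction.orbitRel_apply.1 ((MulAction.orbitRel A X).symm h)
  choose c hc using hrep
  refine ⟨fun x => τ (c x) (Quotient.out (Quotient.mk (MulAction.orbitRel A X) x)), ?_⟩
  intro a x
  have hq : Quotient.mk (MulAction.orbitRel A X) (a • x) =
      Quotient.mk (MulAction.orbitRel A X) x :=
    Quotient.sound (MulAction.orbitRel_apply.2 ⟨a, rfl⟩)
  have hca : c (a • x) = a * c x := by
    have h := hc (a • x)
    rw [hq] at h
    have hfix : ((c x)⁻¹ * a⁻¹ * c (a • x)) •
        (Quotient.out (Quotient.mk (MulAction.orbitRel A X) x)) =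
        Quotient.out (Quotient.mk (MulAction.orbitRel A X) x) := by
      rw [mul_smul, h, mul_smul, inv_smul_smul, inv_smul_eq_iff, hc]
    have := hfree _ _ hfix
    rw [mul_assoc, inv_mul_eq_one, eq_inv_mul_iff_mul_eq] at this
    exact this.symm
  simp only [hq, hca, hτ, hc, add_sub_cancel_right]

section CrossedHom

variable {F X M κ : Type*} [Group F] [MulAction F X] [AddCommGroup M]

lemma crossedHom_one {τ : F → X → M} (hτ : ∀ u v x, τ (u * v) x = τ u (v • x) + τ v x) (x : X) :
    τ 1 x = 0 := by
  simpa using hτ 1 1 x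

lemma derivation_one {d : F → MonoidAlgebra ℤ F}
    (hd : ∀ u v, d (u * v) = d u * MonoidAlgebra.of ℤ F v + d v) : d 1 = 0 := by
  simpa [map_one, -MonoidAlgebra.of_apply] using hd 1 1

/-- The elements on which the crossed homomorphism `τ` is the combination of the derivations
`D k` with coefficients `f k`. -/
def foxExpansionSubgroup (D : κ → F → MonoidAlgebra ℤ F)
    (hD : ∀ k u v, D k (u * v) = D k u * MonoidAlgebra.of ℤ F v + D k v)
    (τ : F → X → M) (hτ : ∀ u v x, τ (u * v) x = τ u (v • x) + τ v x) (f : κ → X → M) :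
    Subgroup F where
  carrier := {v | ∃ S : Finset κ, ∀ T, S ⊆ T → ∀ x, τ v x = ∑ k ∈ T, pairing (f k) x (D k v)}
  one_mem' := ⟨∅, fun T _ x => by
    simp [crossedHom_one hτ, fun k => derivation_one (hD k)]⟩
  mul_mem' := by
    classical
    rintro u v ⟨S, hS⟩ ⟨S', hS'⟩
    refine ⟨S ∪ S', fun T hT x => ?_⟩
    rw [hτ, hS T (Finset.union_subset_left hT), hS' T (Finset.union_subset_right hT),
      ← Finset.sum_add_distrib]
    simp only [hD, map_add, pairing_mul_of]
  inv_mem' := by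
    rintro v ⟨S, hS⟩
    refine ⟨S, fun T hT x => ?_⟩
    have hτv : τ v⁻¹ x = -τ v (v⁻¹ • x) := by
      have h := hτ v v⁻¹ x
      rw [mul_inv_cancel, crossedHom_one hτ] at h
      exact (neg_eq_of_add_eq_zero_right h.symm).symm
    have hDv : ∀ k, D k v⁻¹ = -(D k v * MonoidAlgebra.of ℤ F v⁻¹) := by
      intro k
      have h := hD k v v⁻¹
      rw [mul_inv_cancel, derivation_one (hD k)] at h
      exact (neg_eq_of_add_eq_zero_right h.symm).symm
    rw [hτv, hS T hT, ← Finset.sum_neg_distrib]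
    simp only [hDv, map_neg, pairing_mul_of]

/-- Modulo the left ideal generated by the `n - 1`, a derivation is additive on `N`, hence
vanishes on `[N, N]`. -/
lemma derivation_mem_span_of_mem_commutator {N : Subgroup F} {d : F → MonoidAlgebra ℤ F}
    (hd : ∀ u v, d (u * v) = d u * MonoidAlgebra.of ℤ F v + d v) {v : F} (hv : v ∈ ⁅N, N⁆) :
    d v ∈ Ideal.span {z : MonoidAlgebra ℤ F | ∃ n ∈ N, z = MonoidAlgebra.of ℤ F n - 1} := by
  set I := Ideal.span {z : MonoidAlgebra ℤ F | ∃ n ∈ N, z = MonoidAlgebra.of ℤ F n - 1} with hI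
  let φ : N →* Multiplicative (MonoidAlgebra ℤ F ⧸ I.toAddSubgroup) :=
    MonoidHom.mk' (fun n => Multiplicative.ofAdd (QuotientAddGroup.mk (d n))) (by
      intro a b
      rw [← ofAdd_add, ← QuotientAddGroup.mk_add]
      refine congrArg Multiplicative.ofAdd (QuotientAddGroup.eq.2 ?_)
      have h : -d ↑(a * b) + (d a + d b) = -d a * (MonoidAlgebra.of ℤ F (b : F) - 1) := by
        rw [Subgroup.coe_mul, hd, mul_sub, mul_one, neg_mul]
        abel
      rw [h]
      exact I.mul_mem_left _ (Ideal.subset_span ⟨b, b.2, rfl⟩))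
  rw [← Subgroup.map_subtype_commutator] at hv
  obtain ⟨n, hn, rfl⟩ := hv
  have hφ : φ n = 1 := Abelianization.commutator_subset_ker φ hn
  exact (QuotientAddGroup.eq_zero_iff _).1 (congrArg Multiplicative.toAdd hφ)

end CrossedHom

section Schreier

variable {F : Type*} [Group F] (N : Subgroup F)

lemma smul_quotient_eq_self [hN : N.Normal] {n : F} (hn : n ∈ N) (x : F ⧸ N) : n • x = x := by
  induction x using QuotientGroup.induction_on with
  | H g =>
    rw [MulAction.Quotient.smul_mk, QuotientGroup.eq, smul_eq_mul]
    simpa [mul_assoc] using hN.conj_mem _ (N.inv_mem hn) g⁻¹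

lemma mem_of_smul_quotient_eq_self [hN : N.Normal] {g : F} {x : F ⧸ N} (h : g • x = x) : g ∈ N := by
  induction x using QuotientGroup.induction_on with
  | H y =>
    rw [MulAction.Quotient.smul_mk, QuotientGroup.eq, smul_eq_mul] at h
    have := N.inv_mem (hN.conj_mem _ h y)
    simpa [mul_assoc] using this

lemma schreier_mem (v : F) (x : F ⧸ N) : (v • x).out⁻¹ * (v * x.out) ∈ N := by
  rw [← QuotientGroup.eq, QuotientGroup.out_eq', ← smul_eq_mul, ← MulAction.Quotient.smul_mk,
    QuotientGroup.out_eq']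

/-- The Kaloujnine–Krasner crossed homomorphism from `F` to the functions `F ⧸ N → N / [N, N]`. -/
def schreierCocycle (v : F) (x : F ⧸ N) : Additive (Abelianization N) :=
  Additive.ofMul (Abelianization.of ⟨(v • x).out⁻¹ * (v * x.out), schreier_mem N v x⟩)

lemma schreierCocycle_mul (u v : F) (x : F ⧸ N) :
    schreierCocycle N (u * v) x = schreierCocycle N u (v • x) + schreierCocycle N v x := by
  rw [schreierCocycle, schreierCocycle, schreierCocycle, ← ofMul_mul, ← map_mul]
  refine congrArg (fun n => Additive.ofMul (Abelianization.of n)) (Subtype.ext ?_)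
  simp [mul_smul, mul_assoc]

lemma mem_commutator_of_schreierCocycle_eq_zero [N.Normal] {v : F} (hv : v ∈ N) {x : F ⧸ N}
    (h : schreierCocycle N v x = 0) : v ∈ ⁅N, N⁆ := by
  have h' : (⟨(v • x).out⁻¹ * (v * x.out), schreier_mem N v x⟩ : N) ∈ commutator N := by
    rw [← Abelianization.ker_of]
    exact congrArg Additive.toMul h
  have hmem := Subgroup.mem_map_of_mem N.subtype h'
  rw [Subgroup.map_subtype_commutator] at hmem
  have hconj := (inferInstance : (⁅N, N⁆).Normal).conj_mem _ hmem x.out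
  simpa [smul_quotient_eq_self N hv, mul_assoc] using hconj

end Schreier

/-- The free product is generated by the factors `A i` and the free generators. -/
lemma subgroup_eq_top_of_generators_mem {ι J : Type} {A : ι → Type} [∀ i, Group (A i)]
    {K : Subgroup (CoprodI (mixedFam ι J A))} (ha : ∀ i (a : A i), aEmb A i a ∈ K)
    (hg : ∀ j, gGen A j ∈ K) (v : CoprodI (mixedFam ι J A)) : v ∈ K := by
  induction v using CoprodI.induction_on with
  | one => exact K.one_mem
  | mul x y hx hy => exact K.mul_mem hx hy
  | of k m =>
    rcases k with i | j
    · exact ha i m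
    · let φ : Multiplicative ℤ →* CoprodI (mixedFam ι J A) :=
        (CoprodI.of : mixedFam ι J A (Sum.inr j) →* CoprodI (mixedFam ι J A))
      have hφ : ∀ m : Multiplicative ℤ, φ m = φ (Multiplicative.ofAdd 1) ^ m.toAdd := by
        intro m
        rw [← map_zpow, ← ofAdd_zsmul, smul_eq_mul, mul_one, ofAdd_toAdd]
      refine (hφ m).symm ▸ ?_
      exact K.zpow_mem (hg j) _

/-- **Corollary (Romanovskii).**  With `F = (*_i A i) * (free group on J)` and `N` a normal
subgroup with `N ∩ A i = 1` for all `i`, and Fox derivatives `D k` as above: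
for `v : F`, `D k v ∈ ℤ[F]·(N - 1)` for all `k ∈ ι ⊕ J` iff `v ∈ [N, N]`. -/
theorem statement3 {ι J : Type} (A : ι → Type) [∀ i, Group (A i)]
    [∀ i, Nontrivial (A i)]
    (N : Subgroup (CoprodI (mixedFam ι J A))) [N.Normal]
    (hNA : ∀ i : ι, N ⊓ (aEmb A i (J := J)).range = ⊥)
    (D : ι ⊕ J → CoprodI (mixedFam ι J A) →
      MonoidAlgebra ℤ (CoprodI (mixedFam ι J A)))
    (hDmul : ∀ k u v, D k (u * v)
      = D k u * MonoidAlgebra.of ℤ (CoprodI (mixedFam ι J A)) v + D k v)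
    (hDg : ∀ j : J, D (Sum.inr j) (gGen A j) = 1)
    (hDg' : ∀ (k : ι ⊕ J) (j : J), k ≠ Sum.inr j → D k (gGen A j) = 0)
    (hDa : ∀ (i : ι) (a : A i), D (Sum.inl i) (aEmb A i a)
      = MonoidAlgebra.of ℤ (CoprodI (mixedFam ι J A)) (aEmb A i a) - 1)
    (hDa' : ∀ (k : ι ⊕ J) (i : ι) (a : A i), k ≠ Sum.inl i → D k (aEmb A i a) = 0)
    (v : CoprodI (mixedFam ι J A)) :
    (∀ k : ι ⊕ J, D k v ∈ Ideal.span
        {x : MonoidAlgebra ℤ (CoprodI (mixedFam ι J A)) |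
          ∃ n ∈ N, x = MonoidAlgebra.of ℤ (CoprodI (mixedFam ι J A)) n - 1})
      ↔ v ∈ ⁅N, N⁆ := by
  have hvanish : ∀ {M : Type} [AddCommGroup M]
      (τ : CoprodI (mixedFam ι J A) → CoprodI (mixedFam ι J A) ⧸ N → M)
      (_ : ∀ u v x, τ (u * v) x = τ u (v • x) + τ v x)
      (f : ι → CoprodI (mixedFam ι J A) ⧸ N → M)
      (_ : ∀ i (a : A i) x, τ (aEmb A i a) x = f i (aEmb A i (J := J) a • x) - f i x),
      (∀ k : ι ⊕ J, D k v ∈ Ideal.span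
        {x : MonoidAlgebra ℤ (CoprodI (mixedFam ι J A)) |
          ∃ n ∈ N, x = MonoidAlgebra.of ℤ (CoprodI (mixedFam ι J A)) n - 1}) →
      ∀ x, τ v x = 0 := by
    intro M _ τ hτ f hf hv x
    obtain ⟨S, hS⟩ : v ∈ foxExpansionSubgroup D hDmul τ hτ
        (Sum.elim f fun j => τ (gGen A j)) := by
      refine subgroup_eq_top_of_generators_mem (fun i a => ?_) (fun j => ?_) v
      · refine ⟨{Sum.inl i}, fun T hT x => ?_⟩
        rw [Finset.sum_eq_single_of_mem (Sum.inl i) (Finset.singleton_subset_iff.1 hT)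
          fun k _ hk => by rw [hDa' k i a hk, map_zero],
          hDa, map_sub, pairing_of, pairing_one, hf, Sum.elim_inl]
      · refine ⟨{Sum.inr j}, fun T hT x => ?_⟩
        rw [Finset.sum_eq_single_of_mem (Sum.inr j) (Finset.singleton_subset_iff.1 hT)
          fun k _ hk => by rw [hDg' k j hk, map_zero],
          hDg, pairing_one, Sum.elim_inr]
    rw [hS S subset_rfl]
    exact Finset.sum_eq_zero fun k _ =>
      pairing_eq_zero_of_mem_span (fun n hn x => smul_quotient_eq_self N hn x) _ _ (hv k)
  refine ⟨fun hv => ?_, fun hv k => derivation_mem_span_of_mem_commutator (hDmul k) hv⟩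
  have hvN : v ∈ N := by
    have h := hvanish (M := CoprodI (mixedFam ι J A) ⧸ N →₀ ℤ)
      (fun u x => Finsupp.single (u • x) 1 - Finsupp.single x 1)
      (fun u w x => by rw [mul_smul, sub_add_sub_cancel])
      (fun _ x => Finsupp.single x 1) (fun _ _ _ => rfl) hv (QuotientGroup.mk 1)
    exact mem_of_smul_quotient_eq_self N
      (Finsupp.single_left_injective one_ne_zero (sub_eq_zero.1 h))
  have hfree : ∀ (i : ι) (a : A i) (x : CoprodI (mixedFam ι J A) ⧸ N),
      aEmb A i (J := J) a • x = x → a = 1 := by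
    intro i a x h
    have hmem : aEmb A i a ∈ N ⊓ (aEmb A i (J := J)).range :=
      ⟨mem_of_smul_quotient_eq_self N h, a, rfl⟩
    rw [hNA i, Subgroup.mem_bot] at hmem
    exact CoprodI.of_injective (M := mixedFam ι J A) (Sum.inl i) (hmem.trans (map_one _).symm)
  have hpot : ∀ i : ι, ∃ f : CoprodI (mixedFam ι J A) ⧸ N → Additive (Abelianization N),
      ∀ (a : A i) x, schreierCocycle N (aEmb A i a) x = f (aEmb A i (J := J) a • x) - f x := by
    intro i
    let _ : MulAction (A i) (CoprodI (mixedFam ι J A) ⧸ N) :=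
      MulAction.compHom _ (aEmb A i (J := J))
    exact exists_potential_of_free (hfree i) (fun a => schreierCocycle N (aEmb A i a))
      fun a b x => by rw [map_mul]; exact schreierCocycle_mul N _ _ x
  choose f hf using hpot
  exact mem_commutator_of_schreierCocycle_eq_zero N hvN
    (hvanish (schreierCocycle N) (schreierCocycle_mul N) f hf hv (QuotientGroup.mk 1))
end
end
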